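/- Let G be a connected finite simple chordal graph, i.e., G contains no induced cycle of length at least 4. Then χ_D(G) ≤ Δ(G) + 1. -/

import Mathlib

open SimpleGraph

/-- A proper colouring `c` of `G` is distinguishing if the identity is the only
automorphism of `G` preserving `c`. -/
def SimpleGraph.IsDistinguishingColoring {V α : Type*} (G : SimpleGraph V)
    (c : G.Coloring α) : Prop :=
  ∀ φ : G ≃g G, (∀ v, c (φ v) = c v) → ∀ v, φ v = v

/-- The distinguishing chromatic number of `G`: the least `k` such that `G` has a
proper vertex colouring with `k` colours preserved only by the identity automorphism. -/
noncomputable def SimpleGraph.distChromNum {V : Type*} (G : SimpleGraph V) : ℕ :=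
  sInf {k | ∃ c : G.Coloring (Fin k), G.IsDistinguishingColoring c}

/-- The maximum degree of `G`, stated without decidability assumptions. -/
noncomputable def SimpleGraph.maxDeg {V : Type*} [Fintype V] (G : SimpleGraph V) : ℕ := by
  classical exact G.maxDegree

/-- `G` contains no induced subgraph isomorphic to `H`. -/
def SimpleGraph.IsFreeOf {V W : Type*} (G : SimpleGraph V) (H : SimpleGraph W) : Prop :=
  ¬ Nonempty (H ↪g G)



namespace ChordalDist

theorem no_cycle {V : Type*} (G : SimpleGraph V)
    (hchordal : ∀ n : ℕ, 4 ≤ n → G.IsFreeOf (cycleGraph n))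
    (n : ℕ) (hn : 4 ≤ n) (f : ℕ → V)
    (hinj : ∀ i j, i < j → j < n → f i ≠ f j)
    (hadj : ∀ i j, i < j → j < n → (G.Adj (f i) (f j) ↔ (j = i + 1 ∨ (i = 0 ∧ j + 1 = n)))) :
    False := by
  apply hchordal n hn
  have key : ∀ i j : Fin n, i.val < j.val →
      ((cycleGraph n).Adj i j ↔ (j.val = i.val + 1 ∨ (i.val = 0 ∧ j.val + 1 = n))) := by
    intro i j hij
    have hi := i.isLt
    have hj := j.isLt
    rw [cycleGraph_adj', Fin.sub_val_of_le (a := j) (b := i) hij.le,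
      Fin.coe_sub_iff_lt.2 (show i < j from hij)]
    omega
  refine ⟨⟨⟨fun i => f i.val, ?_⟩, ?_⟩⟩
  · intro i j hij
    rcases lt_trichotomy i.val j.val with h | h | h
    · exact absurd hij (hinj _ _ h j.isLt)
    · exact Fin.ext h
    · exact absurd hij.symm (hinj _ _ h i.isLt)
  · intro i j
    change G.Adj (f i.val) (f j.val) ↔ _
    rcases lt_trichotomy i.val j.val with h | h | h
    · rw [hadj _ _ h j.isLt, key _ _ h]
    · obtain rfl : i = j := Fin.ext h
      simp
    · rw [G.adj_comm, (cycleGraph n).adj_comm, hadj _ _ h i.isLt, key _ _ h]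

theorem exists_parent {V : Type*} (G : SimpleGraph V) (hconn : G.Connected) (r w : V)
    (hw : w ≠ r) : ∃ p, G.Adj w p ∧ G.dist r p + 1 = G.dist r w := by
  obtain ⟨q, hq⟩ := hconn.exists_walk_length_eq_dist w r
  cases q with
  | nil => exact absurd rfl hw
  | @cons _ p _ h q =>
    refine ⟨p, h, ?_⟩
    have h1 : G.dist p r ≤ q.length := dist_le q
    have h2 := hconn.dist_triangle (u := w) (v := p) (w := r)
    rw [dist_eq_one_iff_adj.2 h] at h2
    rw [Walk.length_cons] at hq
    rw [dist_comm (u := r), dist_comm (u := r)]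
    omega

theorem short_path {V : Type*} (G : SimpleGraph V) (hconn : G.Connected) (r a b : V)
    (hab : a ≠ b) (hd : G.dist r a = G.dist r b) :
    ∃ (m : ℕ) (f : ℕ → V), 1 ≤ m ∧ f 0 = a ∧ f m = b ∧
      (∀ k l, k < l → l ≤ m → f k ≠ f l) ∧
      (∀ k l, k < l → l ≤ m → (G.Adj (f k) (f l) ↔ l = k + 1)) ∧
      (∀ k, 0 < k → k < m → G.dist r (f k) < G.dist r a) := by
  let S : Set V := {w | G.dist r w < G.dist r a ∨ w = a ∨ w = b}
  let H : SimpleGraph V :=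
    { Adj := fun x y => G.Adj x y ∧ x ∈ S ∧ y ∈ S
      symm := ⟨fun x y h => ⟨h.1.symm, h.2.2, h.2.1⟩⟩
      loopless := ⟨fun x h => h.1.ne rfl⟩ }
  have hreach : ∀ d w, G.dist r w = d → w ∈ S → H.Reachable w r := by
    intro d
    induction d with
    | zero =>
      intro w hw _
      rw [hconn.dist_eq_zero_iff] at hw
      subst hw
      exact Reachable.refl _
    | succ d ih =>
      intro w hw hS
      have hne : w ≠ r := by
        rintro rfl
        simp at hw
      obtain ⟨p, hp, hpd⟩ := exists_parent G hconn r w hne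
      have hpS : p ∈ S := by
        left
        rcases hS with h | rfl | rfl <;> omega
      have hH : H.Adj w p := ⟨hp, hS, hpS⟩
      exact hH.reachable.trans (ih p (by omega) hpS)
  have haS : a ∈ S := Or.inr (Or.inl rfl)
  have hbS : b ∈ S := Or.inr (Or.inr rfl)
  have hr : H.Reachable a b := (hreach _ a rfl haS).trans (hreach _ b rfl hbS).symm
  obtain ⟨p, hp⟩ := hr.exists_walk_length_eq_dist
  have hpath := p.isPath_of_length_eq_dist hp
  have hinj := hpath.getVert_injOn
  have hne : ∀ k l, k < l → l ≤ p.length → p.getVert k ≠ p.getVert l := by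
    intro k l hkl hl he
    have := hinj (show k ≤ p.length by omega) (show l ≤ p.length from hl) he
    omega
  have hSm : ∀ k, k ≤ p.length → p.getVert k ∈ S := by
    intro k hk
    rcases Nat.eq_zero_or_pos k with rfl | h0
    · simpa using haS
    · have := p.adj_getVert_succ (i := k - 1) (by omega)
      rw [Nat.sub_add_cancel h0] at this
      exact this.2.2
  refine ⟨p.length, p.getVert, ?_, by simp, by simp, hne, ?_, ?_⟩
  · by_contra h
    have : p.length = 0 := by omega
    exact hab (Walk.eq_of_length_eq_zero this)
  · intro k l hkl hl
    constructor
    · intro h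
      have hH : H.Adj (p.getVert k) (p.getVert l) := ⟨h, hSm _ (by omega), hSm _ hl⟩
      have := dist_le ((p.take k).append (Walk.cons hH (p.drop l)))
      simp at this
      omega
    · rintro rfl
      exact (p.adj_getVert_succ (by omega)).1
  · intro k h0 hk
    rcases hSm k hk.le with h | h | h
    · exact h
    · exact absurd (by simpa using h.symm) (hne 0 k h0 hk.le)
    · exact absurd (by simpa using h) (hne k p.length hk le_rfl)

theorem not_adj_of_dist {V : Type*} (G : SimpleGraph V) (hconn : G.Connected) (r x y : V)
    (h : G.dist r x + 1 < G.dist r y) : ¬ G.Adj x y := by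
  intro hxy
  have h2 := hconn.dist_triangle (u := r) (v := x) (w := y)
  rw [dist_eq_one_iff_adj.2 hxy] at h2
  omega

theorem clique {V : Type*} (G : SimpleGraph V) (hconn : G.Connected)
    (hchordal : ∀ n : ℕ, 4 ≤ n → G.IsFreeOf (cycleGraph n)) (r v a b : V)
    (hab : a ≠ b) (ha : G.Adj v a) (hb : G.Adj v b)
    (hda : G.dist r a + 1 = G.dist r v) (hdb : G.dist r b + 1 = G.dist r v) : G.Adj a b := by
  by_contra hnab
  obtain ⟨m, f, hm, h0, hmb, hinj, hadj, hint⟩ := short_path G hconn r a b hab (by omega)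
  have hm2 : 2 ≤ m := by
    by_contra h
    obtain rfl : m = 1 := by omega
    have := (hadj 0 1 (by omega) le_rfl).2 rfl
    rw [h0, hmb] at this
    exact hnab this
  have hle : ∀ k, k ≤ m → G.dist r (f k) < G.dist r v := by
    intro k hk
    rcases Nat.eq_zero_or_pos k with rfl | h
    · rw [h0]; omega
    rcases hk.eq_or_lt with rfl | h'
    · rw [hmb]; omega
    have := hint k h h'
    omega
  refine no_cycle G hchordal (m + 2) (by omega) (fun k => if k ≤ m then f k else v) ?_ ?_
  · intro i j hij hj
    have hi : i ≤ m := by omega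
    simp only [hi, if_true]
    split_ifs with h
    · exact hinj i j hij h
    · intro he
      have := hle i hi
      rw [he] at this
      omega
  · intro i j hij hj
    have hi : i ≤ m := by omega
    simp only [hi, if_true]
    split_ifs with h
    · rw [hadj i j hij h]
      omega
    · obtain rfl : j = m + 1 := by omega
      rcases Nat.eq_zero_or_pos i with rfl | hi0
      · rw [h0]
        exact ⟨fun _ => by omega, fun _ => ha.symm⟩
      rcases hi.eq_or_lt with rfl | h'
      · rw [hmb]
        exact ⟨fun _ => by omega, fun _ => hb.symm⟩
      have := hint i hi0 h'
      constructor
      · intro hh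
        exact absurd hh (not_adj_of_dist G hconn r _ _ (by omega))
      · intro hh
        omega

theorem nested {V : Type*} (G : SimpleGraph V) (hconn : G.Connected)
    (hchordal : ∀ n : ℕ, 4 ≤ n → G.IsFreeOf (cycleGraph n)) (r u v a b : V)
    (huv : G.Adj u v) (ha : G.Adj u a) (hb : G.Adj v b)
    (hna : ¬ G.Adj v a) (hnb : ¬ G.Adj u b)
    (hd : G.dist r u = G.dist r v)
    (hda : G.dist r a + 1 = G.dist r v) (hdb : G.dist r b + 1 = G.dist r v) : False := by
  have hab : a ≠ b := by
    rintro rfl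
    exact hna hb
  obtain ⟨m, f, hm, h0, hmb, hinj, hadj, hint⟩ := short_path G hconn r a b hab (by omega)
  have hle : ∀ k, k ≤ m → G.dist r (f k) < G.dist r v := by
    intro k hk
    rcases Nat.eq_zero_or_pos k with rfl | h
    · rw [h0]; omega
    rcases hk.eq_or_lt with rfl | h'
    · rw [hmb]; omega
    have := hint k h h'
    omega
  refine no_cycle G hchordal (m + 3) (by omega)
    (fun k => if k ≤ m then f k else if k = m + 1 then v else u) ?_ ?_
  · intro i j hij hj
    by_cases hi : i ≤ m
    · simp only [hi, if_true]
      split_ifs with h h'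
      · exact hinj i j hij h
      · intro he
        have := hle i hi
        rw [he] at this
        omega
      · intro he
        have := hle i hi
        rw [he] at this
        omega
    · obtain rfl : i = m + 1 := by omega
      obtain rfl : j = m + 2 := by omega
      simpa using huv.ne.symm
  · intro i j hij hj
    by_cases hi : i ≤ m
    · simp only [hi, if_true]
      split_ifs with h hj1
      · rw [hadj i j hij h]
        omega
      · subst hj1
        rcases hi.eq_or_lt with rfl | h'
        · rw [hmb]
          exact ⟨fun _ => by omega, fun _ => hb.symm⟩
        rcases Nat.eq_zero_or_pos i with rfl | hi0
        · rw [h0]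
          exact ⟨fun hh => absurd hh.symm hna, fun hh => by omega⟩
        have := hint i hi0 h'
        exact ⟨fun hh => absurd hh (not_adj_of_dist G hconn r _ _ (by omega)),
          fun hh => by omega⟩
      · obtain rfl : j = m + 2 := by omega
        rcases Nat.eq_zero_or_pos i with rfl | hi0
        · rw [h0]
          exact ⟨fun _ => by omega, fun _ => ha.symm⟩
        rcases hi.eq_or_lt with rfl | h'
        · rw [hmb]
          exact ⟨fun hh => absurd hh.symm hnb, fun hh => by omega⟩
        have := hint i hi0 h'
        exact ⟨fun hh => absurd hh (not_adj_of_dist G hconn r _ _ (by omega)),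
          fun hh => by omega⟩
    · obtain rfl : i = m + 1 := by omega
      obtain rfl : j = m + 2 := by omega
      simpa using huv.symm

open Classical in
theorem greedy {V : Type*} (K : SimpleGraph V) (D : ℕ) (s : Finset V)
    (h : ∀ t ⊆ s, t.Nonempty → ∃ v ∈ t, (t.filter (fun u => K.Adj v u)).card ≤ D) :
    ∃ c : V → Fin (D + 1), ∀ u ∈ s, ∀ v ∈ s, K.Adj u v → c u ≠ c v := by
  induction hn : s.card generalizing s with
  | zero =>
    rw [Finset.card_eq_zero] at hn
    subst hn
    exact ⟨fun _ => 0, by simp⟩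
  | succ n ih =>
    have hne : s.Nonempty := by
      rw [← Finset.card_pos]; omega
    obtain ⟨v, hv, hcard⟩ := h s subset_rfl hne
    obtain ⟨c, hc⟩ := ih (s.erase v)
      (fun t ht => h t (ht.trans (Finset.erase_subset _ _)))
      (by rw [Finset.card_erase_of_mem hv]; omega)
    obtain ⟨x, hx⟩ : ∃ x, x ∉ (s.filter (fun u => K.Adj v u)).image c := by
      by_contra hcon
      push Not at hcon
      have h1 : (Finset.univ : Finset (Fin (D + 1))) ⊆ (s.filter (fun u => K.Adj v u)).image c :=
        fun y _ => hcon y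
      have h2 := Finset.card_le_card h1
      have h3 := Finset.card_image_le (s := s.filter (fun u => K.Adj v u)) (f := c)
      simp only [Finset.card_univ, Fintype.card_fin] at h2
      omega
    have hx' : ∀ u ∈ s, K.Adj v u → c u ≠ x := by
      intro u hu huv he
      exact hx (Finset.mem_image.2 ⟨u, Finset.mem_filter.2 ⟨hu, huv⟩, he⟩)
    refine ⟨Function.update c v x, ?_⟩
    intro u hu w hw huw
    by_cases h1 : u = v
    · subst h1
      rw [Function.update_self, Function.update_of_ne huw.ne.symm]
      exact (hx' w hw huw).symm
    · by_cases h2 : w = v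
      · subst h2
        rw [Function.update_self, Function.update_of_ne h1]
        exact hx' u hu huw.symm
      · rw [Function.update_of_ne h1, Function.update_of_ne h2]
        exact hc u (Finset.mem_erase.2 ⟨h1, hu⟩) w (Finset.mem_erase.2 ⟨h2, hw⟩) huw

theorem dist_iso {V : Type*} (G : SimpleGraph V) (hconn : G.Connected) (φ : G ≃g G) (u v : V) :
    G.dist (φ u) (φ v) = G.dist u v := by
  have key : ∀ (ψ : G ≃g G) (u v : V), G.dist (ψ u) (ψ v) ≤ G.dist u v := by
    intro ψ u v
    obtain ⟨p, hp⟩ := hconn.exists_walk_length_eq_dist u v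
    rw [← hp]
    have := dist_le (p.map ψ.toHom)
    rw [Walk.length_map] at this
    exact this
  apply le_antisymm (key φ u v)
  have := key φ.symm (φ u) (φ v)
  simpa using this

open Classical in
/-- Lower neighbours of `v` in the breadth-first layering from `r`. -/
noncomputable def low {V : Type*} [Fintype V] (G : SimpleGraph V) (r v : V) : Finset V :=
  Finset.univ.filter (fun w => G.Adj v w ∧ G.dist r w + 1 = G.dist r v)

theorem mem_low {V : Type*} [Fintype V] (G : SimpleGraph V) (r v w : V) :
    w ∈ low G r v ↔ G.Adj v w ∧ G.dist r w + 1 = G.dist r v := by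
  simp [low]

/-- The conflict graph. -/
def conflict {V : Type*} [Fintype V] (G : SimpleGraph V) (r : V) : SimpleGraph V where
  Adj u v := u ≠ v ∧ (G.Adj u v ∨ u = r ∨ v = r ∨
    (G.dist r u = G.dist r v ∧ low G r u = low G r v))
  symm := ⟨fun u v h => ⟨h.1.symm, by
    rcases h.2 with h | h | h | h
    · exact Or.inl h.symm
    · exact Or.inr (Or.inr (Or.inl h))
    · exact Or.inr (Or.inl h)
    · exact Or.inr (Or.inr (Or.inr ⟨h.1.symm, h.2.symm⟩))⟩⟩
  loopless := ⟨fun u h => h.1 rfl⟩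

open Classical in
theorem degen {V : Type*} [Fintype V] (G : SimpleGraph V) (hconn : G.Connected)
    (hchordal : ∀ n : ℕ, 4 ≤ n → G.IsFreeOf (cycleGraph n)) (r : V)
    (t : Finset V) (ht : t.Nonempty) :
    ∃ v ∈ t, (t.filter (fun u => (conflict G r).Adj v u)).card ≤ G.maxDegree := by
  obtain ⟨v₀, hv₀, hmax⟩ := Finset.exists_max_image t (fun v => G.dist r v) ht
  obtain ⟨v, hv, hmin⟩ := Finset.exists_min_image
    (t.filter (fun v => G.dist r v = G.dist r v₀)) (fun v => (low G r v).card)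
    ⟨v₀, by simp [hv₀]⟩
  rw [Finset.mem_filter] at hv
  have hmax' : ∀ u ∈ t, G.dist r u ≤ G.dist r v := by
    intro u hu
    rw [hv.2]
    exact hmax u hu
  have hmin' : ∀ u ∈ t, G.dist r u = G.dist r v → (low G r v).card ≤ (low G r u).card := by
    intro u hu hd
    exact hmin u (Finset.mem_filter.2 ⟨hu, hd.trans hv.2⟩)
  refine ⟨v, hv.1, ?_⟩
  by_cases hvr : v = r
  · have : t.filter (fun u => (conflict G r).Adj v u) = ∅ := by
      apply Finset.filter_eq_empty_iff.2
      intro u hu h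
      have := hmax' u hu
      rw [hvr, SimpleGraph.dist_self, Nat.le_zero, hconn.dist_eq_zero_iff] at this
      exact h.1 (hvr.trans this)
    rw [this]
    simp
  obtain ⟨a, hva, hda⟩ := exists_parent G hconn r v hvr
  -- the conflicting vertices other than the root lie in the closed neighbourhood of `a`
  have key : ∀ u ∈ t, (conflict G r).Adj v u → u ≠ r →
      u ≠ v ∧ G.dist r a ≤ G.dist r u ∧ (u = a ∨ G.Adj a u) := by
    intro u hu hvu hur
    refine ⟨hvu.1.symm, ?_⟩
    rcases hvu.2 with h | h | h | h
    · have h1 := hmax' u hu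
      have h2 : ¬ (G.dist r u + 1 < G.dist r v) := fun h' =>
        not_adj_of_dist G hconn r u v h' h.symm
      refine ⟨by omega, ?_⟩
      by_cases h3 : G.dist r u = G.dist r v
      · right
        by_contra hau
        have hsub : low G r u ⊆ low G r v := by
          intro b hb
          rw [mem_low] at hb ⊢
          refine ⟨?_, by omega⟩
          by_contra hvb
          exact nested G hconn hchordal r u v b a h.symm hb.1 hva hvb
            (fun h' => hau h'.symm) h3 (by omega) hda
        have heq := Finset.eq_of_subset_of_card_le hsub (hmin' u hu h3)
        have : a ∈ low G r u := by
          rw [heq, mem_low]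
          exact ⟨hva, hda⟩
        rw [mem_low] at this
        exact hau this.1.symm
      · by_cases hua : u = a
        · exact Or.inl hua
        · right
          exact clique G hconn hchordal r v a u (Ne.symm hua) hva h hda (by omega)
    · exact absurd h hvr
    · exact absurd h hur
    · refine ⟨by omega, Or.inr ?_⟩
      have : a ∈ low G r u := by
        rw [← h.2, mem_low]
        exact ⟨hva, hda⟩
      rw [mem_low] at this
      exact this.1.symm
  have hdeg := G.degree_le_maxDegree a
  rw [← card_neighborFinset_eq_degree] at hdeg
  by_cases har : a = r
  · have hsub : t.filter (fun u => (conflict G r).Adj v u) ⊆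
        insert a ((G.neighborFinset a).erase v) := by
      intro u hu
      rw [Finset.mem_filter] at hu
      by_cases hur : u = r
      · simp [hur, har]
      · obtain ⟨h1, -, h3⟩ := key u hu.1 hu.2 hur
        simp [h1, h3]
    have h1 := Finset.card_le_card hsub
    have h2 := Finset.card_insert_le a ((G.neighborFinset a).erase v)
    have h3 : v ∈ G.neighborFinset a := by simpa using hva.symm
    have h4 := Finset.card_erase_add_one h3
    omega
  · obtain ⟨p, hap, hdp⟩ := exists_parent G hconn r a har
    have hsub : t.filter (fun u => (conflict G r).Adj v u) ⊆
        insert r (insert a (((G.neighborFinset a).erase v).erase p)) := by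
      intro u hu
      rw [Finset.mem_filter] at hu
      by_cases hur : u = r
      · simp [hur]
      · obtain ⟨h1, h2, h3⟩ := key u hu.1 hu.2 hur
        have hup : u ≠ p := by
          rintro rfl
          omega
        simp [h1, h3, hup]
    have h1 := Finset.card_le_card hsub
    have h2 := Finset.card_insert_le r (insert a (((G.neighborFinset a).erase v).erase p))
    have h2' := Finset.card_insert_le a (((G.neighborFinset a).erase v).erase p)
    have h3 : v ∈ G.neighborFinset a := by simpa using hva.symm
    have h4 := Finset.card_erase_add_one h3
    have h5 : p ∈ (G.neighborFinset a).erase v := by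
      have : p ≠ v := by
        rintro rfl
        omega
      simp [this, hap]
    have h6 := Finset.card_erase_add_one h5
    omega

end ChordalDist

open ChordalDist in
theorem statement_6 {V : Type*} [Fintype V] (G : SimpleGraph V)
    (hconn : G.Connected)
    (hchordal : ∀ n : ℕ, 4 ≤ n → G.IsFreeOf (cycleGraph n)) :
    G.distChromNum ≤ G.maxDeg + 1 := by
  classical
  obtain ⟨r⟩ := hconn.nonempty
  have hmd : G.maxDeg = G.maxDegree := by
    unfold SimpleGraph.maxDeg
    congr!
  rw [hmd]
  obtain ⟨c, hc⟩ := greedy (conflict G r) G.maxDegree Finset.univ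
    (fun t _ ht => by
      obtain ⟨v, hv, h⟩ := degen G hconn hchordal r t ht
      refine ⟨v, hv, ?_⟩
      convert h)
  have hc' : ∀ u v, c u = c v → u ≠ v → ¬ (conflict G r).Adj u v := fun u v h _ h' =>
    hc u (Finset.mem_univ _) v (Finset.mem_univ _) h' h
  apply Nat.sInf_le
  refine ⟨Coloring.mk c (fun {u v} huv => hc u (Finset.mem_univ _) v (Finset.mem_univ _)
    ⟨huv.ne, Or.inl huv⟩), ?_⟩
  intro φ hφ
  replace hφ : ∀ v, c (φ v) = c v := hφ
  have hr : φ r = r := by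
    by_contra h
    exact hc' _ _ (hφ r) h ⟨h, Or.inr (Or.inr (Or.inl rfl))⟩
  have hdist : ∀ v, G.dist r (φ v) = G.dist r v := by
    intro v
    have := dist_iso G hconn φ r v
    rwa [hr] at this
  have main : ∀ d v, G.dist r v = d → φ v = v := by
    intro d
    induction d with
    | zero =>
      intro v hv
      rw [hconn.dist_eq_zero_iff] at hv
      rw [← hv, hr]
    | succ d ih =>
      intro v hv
      by_contra h
      refine hc' _ _ (hφ v) h ⟨h, Or.inr (Or.inr (Or.inr ⟨hdist v, ?_⟩))⟩
      ext w
      rw [mem_low, mem_low, hdist v]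
      refine and_congr_left ?_
      intro hw
      have hw' := ih w (by omega)
      have := φ.map_adj_iff (v := v) (w := w)
      rwa [hw'] at this
  exact fun v => main _ v rfl
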